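/- (Three-term elliptic identity.) For all z, w, u₁, u₂, v ∈ ℂ such that every argument occurring below lies outside the lattice Λ (namely z, w, z−w, v, u₁, u₂, u₁−v, u₂+v, u₁−u₂−v): φ(z, u₁−v)·φ(w, u₂+v)·φ(z−w, v) − φ(z, u₂+v)·φ(w, u₁−v)·φ(z−w, u₁−u₂−v) = φ(z, u₁)·φ(w, u₂)·( E₁(v) − E₁(u₁−u₂−v) + E₁(u₁−v) − E₁(u₂+v) ). -/

import Mathlib

open Complex Matrix Kronecker Finset Filter Topology

noncomputable section

/-- The lattice Λ = ℤ + τℤ. -/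
def Lam (τ : ℂ) : Set ℂ := {z : ℂ | ∃ m n : ℤ, z = (m : ℂ) + (n : ℂ) * τ}

/-- The first Jacobi theta function
ϑ(z) = −∑_{j∈ℤ} exp(πi(j+1/2)²τ + 2πi(j+1/2)(z+1/2)). -/
def theta (τ : ℂ) (z : ℂ) : ℂ :=
  -∑' j : ℤ, Complex.exp ((Real.pi : ℂ) * Complex.I * ((j : ℂ) + 1 / 2) ^ 2 * τ +
      2 * (Real.pi : ℂ) * Complex.I * ((j : ℂ) + 1 / 2) * (z + 1 / 2))

/-- The first Eisenstein function E₁(u) = ϑ′(u)/ϑ(u). -/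
def E1 (τ : ℂ) (u : ℂ) : ℂ := deriv (theta τ) u / theta τ u

/-- The Kronecker function φ(z,u) = ϑ′(0)·ϑ(z+u)/(ϑ(z)·ϑ(u)). -/
def phi (τ : ℂ) (z u : ℂ) : ℂ :=
  deriv (theta τ) 0 * theta τ (z + u) / (theta τ z * theta τ u)

/-- The second Eisenstein function E₂(u) = −E₁′(u). -/
def E2 (τ : ℂ) (u : ℂ) : ℂ := -deriv (E1 τ) u

/-- The Weierstrass ℘-function: ℘(u) = E₂(u) + (1/3)·ϑ‴(0)/ϑ′(0). -/
def wp (τ : ℂ) (u : ℂ) : ℂ :=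
  E2 τ u + (1 / 3) * iteratedDeriv 3 (theta τ) 0 / deriv (theta τ) 0

lemma theta_eq (τ z : ℂ) : theta τ z = -(cexp ((Real.pi : ℂ) * I * τ / 4 + Real.pi * I * (z + 1 / 2)) *
    jacobiTheta₂ (z + 1 / 2 + τ / 2) τ) := by
  rw [theta, jacobiTheta₂, ← tsum_mul_left]
  congr 1
  refine tsum_congr fun j => ?_
  rw [jacobiTheta₂_term, ← Complex.exp_add]
  congr 1
  ring

lemma theta_diff (τ : ℂ) (hτ : 0 < τ.im) : Differentiable ℂ (theta τ) := by
  have h : theta τ = fun z => -(cexp ((Real.pi : ℂ) * I * τ / 4 + Real.pi * I * (z + 1 / 2)) *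
    jacobiTheta₂ (z + 1 / 2 + τ / 2) τ) := funext (theta_eq τ)
  rw [h]
  intro z
  have h1 : DifferentiableAt ℂ (fun z => jacobiTheta₂ (z + 1 / 2 + τ / 2) τ) z :=
    (differentiableAt_jacobiTheta₂_fst (z + 1 / 2 + τ / 2) hτ).comp z
      (f := fun z => z + 1 / 2 + τ / 2) (by fun_prop)
  fun_prop

lemma theta_add_one (τ z : ℂ) : theta τ (z + 1) = - theta τ z := by
  rw [theta_eq, theta_eq, show z + 1 + 1 / 2 + τ / 2 = (z + 1 / 2 + τ / 2) + 1 by ring,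
    jacobiTheta₂_add_left, show (Real.pi : ℂ) * I * τ / 4 + Real.pi * I * (z + 1 + 1 / 2) =
      ((Real.pi : ℂ) * I * τ / 4 + Real.pi * I * (z + 1 / 2)) + Real.pi * I by ring,
    Complex.exp_add _ (Real.pi * I), Complex.exp_pi_mul_I]
  ring

lemma theta_add_tau (τ z : ℂ) : theta τ (z + τ) =
    - (cexp (-(Real.pi * I * τ) - 2 * Real.pi * I * z) * theta τ z) := by
  rw [theta_eq, theta_eq, show z + τ + 1 / 2 + τ / 2 = (z + 1 / 2 + τ / 2) + τ by ring,
    jacobiTheta₂_add_left', ← mul_assoc, ← Complex.exp_add, mul_neg, ← mul_assoc, ← Complex.exp_add,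
    neg_neg, ← neg_mul]
  congr 1
  rw [show (Real.pi : ℂ) * I * τ / 4 + Real.pi * I * (z + τ + 1 / 2) + 
    -Real.pi * I * (τ + 2 * (z + 1 / 2 + τ / 2)) = (-(Real.pi * I * τ) - 2 * Real.pi * I * z + 
      (Real.pi * I * τ / 4 + Real.pi * I * (z + 1 / 2))) - Real.pi * I by ring, Complex.exp_sub _ (Real.pi * I),
      Complex.exp_pi_mul_I]
  ring

lemma theta_neg (τ z : ℂ) : theta τ (-z) = - theta τ z := by
  rw [theta_eq, theta_eq, show -z + 1 / 2 + τ / 2 = -(z - 1 / 2 - τ / 2) by ring,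
    jacobiTheta₂_neg_left, show z + 1 / 2 + τ / 2 = ((z - 1 / 2 - τ / 2) + 1) + τ by ring,
    jacobiTheta₂_add_left', jacobiTheta₂_add_left, ← mul_assoc, ← Complex.exp_add, ← neg_mul]
  congr 1
  rw [show (Real.pi : ℂ) * I * τ / 4 + Real.pi * I * (z + 1 / 2) + 
    -Real.pi * I * (τ + 2 * (z - 1 / 2 - τ / 2 + 1)) = 
      (Real.pi * I * τ / 4 + Real.pi * I * (-z + 1 / 2)) - Real.pi * I by ring, Complex.exp_sub _ (Real.pi * I),
      Complex.exp_pi_mul_I]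
  ring

def thA (τ x : ℂ) : ℂ := jacobiTheta₂ (2 * x) (2 * τ)
def thB (τ x : ℂ) : ℂ := cexp ((Real.pi : ℂ) * I * τ / 2 + 2 * Real.pi * I * x) *
  jacobiTheta₂ (2 * x + τ) (2 * τ)

lemma bij_aux : Function.Bijective (Sum.elim (fun p : ℤ × ℤ => (p.1 + p.2, p.1 - p.2 - 1))
    (fun p : ℤ × ℤ => (p.1 + p.2, p.1 - p.2)) : (ℤ × ℤ) ⊕ (ℤ × ℤ) → ℤ × ℤ) := by
  constructor
  · rintro (⟨a, b⟩ | ⟨a, b⟩) (⟨c, d⟩ | ⟨c, d⟩) h <;> simp at h ⊢ <;> omega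
  · rintro ⟨j, k⟩
    rcases Int.even_or_odd' (j - k) with ⟨n, hn | hn⟩
    · exact ⟨Sum.inr (k + n, n), by simp; omega⟩
    · exact ⟨Sum.inl (k + n + 1, n), by simp; omega⟩

lemma theta_mul (τ : ℂ) (hτ : 0 < τ.im) (x y : ℂ) :
    theta τ (x + y) * theta τ (x - y) = thA τ x * thB τ y - thB τ x * thA τ y := by
  have h2 : 0 < (2 * τ).im := by simpa using hτ
  set t : ℤ → ℂ → ℂ := fun j z => cexp ((Real.pi : ℂ) * I * ((j : ℂ) + 1 / 2) ^ 2 * τ +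
      2 * (Real.pi : ℂ) * I * ((j : ℂ) + 1 / 2) * (z + 1 / 2)) with ht
  set a : ℤ → ℂ → ℂ := fun j z => jacobiTheta₂_term j (2 * z) (2 * τ) with ha
  set b : ℤ → ℂ → ℂ := fun j z => cexp ((Real.pi : ℂ) * I * τ / 2 + 2 * Real.pi * I * z) *
     jacobiTheta₂_term j (2 * z + τ) (2 * τ) with hb
  have st : ∀ z, Summable (fun j => t j z) := by
    intro z
    have := ((summable_jacobiTheta₂_term_iff (z + 1 / 2 + τ / 2) τ).2 hτ).mul_left
      (cexp ((Real.pi : ℂ) * I * τ / 4 + Real.pi * I * (z + 1 / 2)))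
    refine this.congr fun j => ?_
    rw [ht, jacobiTheta₂_term, ← Complex.exp_add]
    congr 1
    ring
  have sa : ∀ z, HasSum (fun j => a j z) (thA τ z) := fun z => hasSum_jacobiTheta₂_term _ h2
  have sb : ∀ z, HasSum (fun j => b j z) (thB τ z) := fun z =>
    (hasSum_jacobiTheta₂_term _ h2).mul_left _
  have prod : ∀ {f g : ℤ → ℂ} {p q : ℂ}, HasSum f p → HasSum g q →
      HasSum (fun x : ℤ × ℤ => f x.1 * g x.2) (p * q) := fun hf hg =>
    hf.mul hg (summable_mul_of_summable_norm hf.summable.norm hg.summable.norm)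
  have key : HasSum (fun p : ℤ × ℤ => t p.1 (x + y) * t p.2 (x - y))
      (thA τ x * thB τ y + -(thB τ x * thA τ y)) := by
    rw [← (Equiv.ofBijective _ bij_aux).hasSum_iff]
    refine HasSum.sum ?_ ?_
    · refine Eq.mpr (congrArg (fun f => HasSum f _) (funext ?_)) (prod (sa x) (sb y))
      rintro ⟨m, n⟩
      simp only [Function.comp_apply, Equiv.ofBijective_apply, Sum.elim_inl, ht, ha, hb,
        jacobiTheta₂_term, ← Complex.exp_add]
      rw [Complex.exp_eq_exp_iff_exists_int]
      refine ⟨m, ?_⟩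
      push_cast
      ring
    · refine Eq.mpr (congrArg (fun f => HasSum f _) (funext ?_)) (prod (sb x) (sa y)).neg
      rintro ⟨m, n⟩
      simp only [Function.comp_apply, Equiv.ofBijective_apply, Sum.elim_inr, ht, ha, hb,
        jacobiTheta₂_term, ← Complex.exp_add]
      rw [← neg_one_mul, ← Complex.exp_pi_mul_I, ← Complex.exp_add, Complex.exp_eq_exp_iff_exists_int]
      refine ⟨m, ?_⟩
      push_cast
      ring
  have e : theta τ (x + y) * theta τ (x - y) = thA τ x * thB τ y + -(thB τ x * thA τ y) := by
    rw [← (prod (st (x + y)).hasSum (st (x - y)).hasSum).unique key]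
    simp only [theta, ht]
    ring
  rw [e]; ring

lemma weier (τ : ℂ) (hτ : 0 < τ.im) (x y a b : ℂ) :
    theta τ (x + y) * theta τ (x - y) * (theta τ (a + b) * theta τ (a - b)) -
    theta τ (x + a) * theta τ (x - a) * (theta τ (y + b) * theta τ (y - b)) +
    theta τ (x + b) * theta τ (x - b) * (theta τ (y + a) * theta τ (y - a)) = 0 := by
  simp only [theta_mul τ hτ]
  ring
lemma jac_ne (τ : ℂ) (hτ : 0 < τ.im) : ∃ z, jacobiTheta₂ z τ ≠ 0 := by
  by_contra! hc
  have h := MeasureTheory.hasSum_integral_of_summable_integral_norm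
    (μ := MeasureTheory.volume.restrict (Set.Ioc (0:ℝ) 1))
    (F := fun (n : ℤ) (x : ℝ) => jacobiTheta₂_term n x τ) ?_ ?_
  · have h0 : ∀ x : ℝ, ∑' n : ℤ, jacobiTheta₂_term n x τ = 0 := fun x => hc x
    simp only [h0, MeasureTheory.integral_zero] at h
    have h1 : ∀ n : ℤ, n ≠ 0 → ∫ x : ℝ in Set.Ioc (0:ℝ) 1, jacobiTheta₂_term n x τ = 0 := by
      intro n hn
      rw [← intervalIntegral.integral_of_le zero_le_one]
      have hne : (2 * Real.pi * I * n : ℂ) ≠ 0 := by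
        simp [Real.pi_ne_zero, hn]
      simp only [jacobiTheta₂_term, Complex.exp_add]
      rw [intervalIntegral.integral_mul_const, integral_exp_mul_complex hne]
      have : cexp (2 * Real.pi * I * n * (1:ℝ)) = 1 := by
        rw [Complex.exp_eq_one_iff]; exact ⟨n, by push_cast; ring⟩
      rw [this]; simp
    have h2 := hasSum_single (0 : ℤ) h1
    have h3 := h.unique h2
    simp [jacobiTheta₂_term] at h3
  · intro n
    have : Continuous fun x : ℝ => jacobiTheta₂_term n x τ := by
      unfold jacobiTheta₂_term; fun_prop
    exact (this.integrableOn_Icc).mono_set Set.Ioc_subset_Icc_self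
  · have h1 := ((summable_jacobiTheta₂_term_iff 0 τ).2 hτ).norm
    refine h1.congr fun n => ?_
    simp [norm_jacobiTheta₂_term]

lemma theta_ne (τ : ℂ) (hτ : 0 < τ.im) : ∃ z, theta τ z ≠ 0 := by
  obtain ⟨z, hz⟩ := jac_ne τ hτ
  refine ⟨z - 1 / 2 - τ / 2, ?_⟩
  rw [theta_eq, show z - 1 / 2 - τ / 2 + 1 / 2 + τ / 2 = z by ring]
  simp [hz]

lemma theta_ne_zero (τ : ℂ) (hτ : 0 < τ.im) (c : ℂ) (hc : c ∉ Lam τ) : theta τ c ≠ 0 := by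
  intro h0
  apply hc
  have hd := theta_diff τ hτ
  have hdc : Differentiable ℂ (fun p => theta τ (p + c)) := hd.comp (by fun_prop)
  have hA : AnalyticOnNhd ℂ (theta τ) Set.univ := fun z _ => hd.analyticAt z
  have hAc : AnalyticOnNhd ℂ (fun p => theta τ (p + c)) Set.univ := fun z _ => hdc.analyticAt z
  obtain ⟨z0, hz0⟩ := theta_ne τ hτ
  -- a common nonzero point
  obtain ⟨q, hq1, hq2⟩ : ∃ q, theta τ q ≠ 0 ∧ theta τ (q + c) ≠ 0 := by
    by_contra! hh
    rcases hA.eq_zero_or_eq_zero_of_mul_eq_zero hAc (fun z _ => by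
      by_cases h : theta τ z = 0
      · simp [h]
      · simp [hh z h]) isPreconnected_univ with h | h
    · exact hz0 (h z0 trivial)
    · exact hz0 (by simpa using h (z0 - c) trivial)
  -- functional equation
  have fe : ∀ p t, theta τ (p + t + c) * theta τ (q - t + c) * (theta τ p * theta τ q) =
      theta τ (p + c) * theta τ (q + c) * (theta τ (p + t) * theta τ (q - t)) := by
    intro p t
    have := weier τ hτ ((p + q) / 2 + c) ((p + q) / 2) ((p - q) / 2 + t) ((p - q) / 2)
    rw [show (p + q) / 2 + c - (p + q) / 2 = c by ring, h0] at this
    rw [show (p + q) / 2 + c + ((p - q) / 2 + t) = p + t + c by ring,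
      show (p + q) / 2 + c - ((p - q) / 2 + t) = q - t + c by ring,
      show (p + q) / 2 + (p - q) / 2 = p by ring,
      show (p + q) / 2 - (p - q) / 2 = q by ring,
      show (p + q) / 2 + c + (p - q) / 2 = p + c by ring,
      show (p + q) / 2 + c - (p - q) / 2 = q + c by ring,
      show (p + q) / 2 + ((p - q) / 2 + t) = p + t by ring,
      show (p + q) / 2 - ((p - q) / 2 + t) = q - t by ring] at this
    linear_combination -this
  have dth : ∀ u, HasDerivAt (theta τ) (deriv (theta τ) u) u := fun u => (hd u).hasDerivAt
  have dplus : ∀ u, HasDerivAt (fun t => theta τ (u + t)) (deriv (theta τ) u) 0 := by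
    intro u
    have := (dth (u + 0)).comp_const_add u 0
    simpa using this
  have dminus : ∀ u, HasDerivAt (fun t => theta τ (u - t)) (-deriv (theta τ) u) 0 := by
    intro u
    have := (dth (u - 0)).comp_const_sub u 0
    simpa using this
  have de : ∀ p, (deriv (theta τ) (p + c) * theta τ (q + c) - theta τ (p + c) * deriv (theta τ) (q + c))
      * (theta τ p * theta τ q) = theta τ (p + c) * theta τ (q + c) *
        (deriv (theta τ) p * theta τ q - theta τ p * deriv (theta τ) q) := by
    intro p
    have e1 := (((dplus (p + c)).mul (dminus (q + c))).mul_const (theta τ p * theta τ q))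
    have e2 := (((dplus p).mul (dminus q)).const_mul (theta τ (p + c) * theta τ (q + c)))
    have e3 := e1.unique (e2.congr_of_eventuallyEq (Filter.Eventually.of_forall fun t => by
      have := fe p t
      simp only [Pi.mul_apply]
      rw [show p + c + t = p + t + c by ring, show q + c - t = q - t + c by ring]
      exact this))
    simp only [add_zero, sub_zero] at e3
    linear_combination e3
  set B := deriv (theta τ) (q + c) / theta τ (q + c) - deriv (theta τ) q / theta τ q with hB
  have ode : ∀ p, deriv (theta τ) (p + c) * theta τ p - theta τ (p + c) * deriv (theta τ) p =
      B * (theta τ p * theta τ (p + c)) := by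
    intro p
    have := de p
    rw [hB]
    field_simp
    linear_combination this
  set R : ℂ → ℂ := fun p => theta τ (p + c) * cexp (-B * p) / theta τ p with hR
  have dR : ∀ p, theta τ p ≠ 0 → HasDerivAt R 0 p := by
    intro p hp
    have d1 : HasDerivAt (fun p => theta τ (p + c)) (deriv (theta τ) (p + c)) p :=
      (dth (p + c)).comp_add_const p c
    have d2 : HasDerivAt (fun p => cexp (-B * p)) (cexp (-B * p) * (-B * 1)) p :=
      ((hasDerivAt_id p).const_mul (-B)).cexp
    have := (d1.mul d2).div (dth p) hp
    refine HasDerivAt.congr_deriv (f := R) this ?_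
    rw [div_eq_zero_iff]
    left
    simp only [Pi.mul_apply]
    linear_combination cexp (-B * p) * ode p
  obtain ⟨ε, hε, hball⟩ := Metric.eventually_nhds_iff_ball.1
    ((dth q).continuousAt.eventually_ne hq1)
  set A := R q with hAdef
  have loc : (fun p => theta τ (p + c)) =ᶠ[𝓝 q] fun p => A * cexp (B * p) * theta τ p := by
    filter_upwards [Metric.ball_mem_nhds q hε] with p hp
    have : R p = A := Metric.isOpen_ball.is_const_of_deriv_eq_zero
      (convex_ball q ε).isPreconnected
      (fun x hx => (dR x (hball x hx)).differentiableAt.differentiableWithinAt)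
      (fun x hx => (dR x (hball x hx)).deriv) hp (Metric.mem_ball_self hε)
    have hp0 := hball p hp
    rw [← this, hR]
    simp only
    field_simp
    rw [mul_assoc, ← Complex.exp_add]
    simp
  clear_value A B
  have glob : (fun p => theta τ (p + c)) = fun p => A * cexp (B * p) * theta τ p := by
    refine hAc.eq_of_eventuallyEq (fun z _ => Differentiable.analyticAt ?_ z) loc
    fun_prop
  have gl : ∀ p, theta τ (p + c) = A * cexp (B * p) * theta τ p := fun p => congrFun glob p
  have hA0 : A ≠ 0 := by
    intro h
    exact hq2 (by rw [gl q, h]; ring)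
  have hP : A * cexp (B * q) * theta τ q ≠ 0 := by
    rw [← gl]; exact hq2
  have k1 : cexp B = 1 := by
    have := gl (q + 1)
    rw [show q + 1 + c = (q + c) + 1 by ring, theta_add_one, theta_add_one, gl q,
      mul_add, mul_one, Complex.exp_add] at this
    have h : (A * cexp (B * q) * theta τ q) * (cexp B - 1) = 0 := by linear_combination this
    rcases mul_eq_zero.1 h with h | h
    · exact absurd h hP
    · exact sub_eq_zero.1 h
  have k2 : cexp (B * τ + 2 * Real.pi * I * c) = 1 := by
    have := gl (q + τ)
    rw [show q + τ + c = (q + c) + τ by ring, theta_add_tau, theta_add_tau, gl q,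
      mul_add B, Complex.exp_add (B * q),
      show -(Real.pi * I * τ) - 2 * Real.pi * I * q = (-(Real.pi * I * τ) - 2 * Real.pi * I * (q + c)) + 
        2 * Real.pi * I * c by ring, Complex.exp_add _ (2 * Real.pi * I * c)] at this
    rw [Complex.exp_add]
    have h : cexp (-(Real.pi * I * τ) - 2 * Real.pi * I * (q + c)) * (A * cexp (B * q) * theta τ q) *
      (cexp (B * τ) * cexp (2 * Real.pi * I * c) - 1) = 0 := by linear_combination this
    rcases mul_eq_zero.1 h with h | h
    · exact absurd h (mul_ne_zero (Complex.exp_ne_zero _) hP)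
    · exact sub_eq_zero.1 h
  obtain ⟨n, hn⟩ := Complex.exp_eq_one_iff.1 k1
  obtain ⟨m, hm⟩ := Complex.exp_eq_one_iff.1 k2
  refine ⟨m, -n, ?_⟩
  have hpi : (2 * Real.pi * I : ℂ) ≠ 0 := by simp [Real.pi_ne_zero]
  apply mul_left_cancel₀ hpi
  push_cast
  rw [hn] at hm
  linear_combination hm

lemma E1_sum (τ : ℂ) (hτ : 0 < τ.im) (a b y : ℂ) (h1 : theta τ (b + y) ≠ 0) (h2 : theta τ (b - y) ≠ 0)
    (h3 : theta τ (b + a) ≠ 0) (h4 : theta τ (b - a) ≠ 0) :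
    (E1 τ (b + y) + E1 τ (b - y) - E1 τ (b + a) - E1 τ (b - a)) *
      (theta τ (b + y) * theta τ (b - y) * theta τ (b + a) * theta τ (b - a)) =
      theta τ (2 * b) * deriv (theta τ) 0 * theta τ (y + a) * theta τ (y - a) := by
  have hd := theta_diff τ hτ
  have dp : ∀ k, HasDerivAt (fun x => theta τ (x + k)) (deriv (theta τ) (b + k)) b := fun k =>
    (hd (b + k)).hasDerivAt.comp_add_const b k
  have dm : ∀ k, HasDerivAt (fun x => theta τ (x - k)) (deriv (theta τ) (b - k)) b := fun k =>
    (hd (b - k)).hasDerivAt.comp_sub_const b k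
  have D := ((((dp y).mul (dm y)).mul_const (theta τ (a + b) * theta τ (a - b))).sub
    (((dp a).mul (dm a)).mul_const (theta τ (y + b) * theta τ (y - b)))).add
    (((dp b).mul (dm b)).mul_const (theta τ (y + a) * theta τ (y - a)))
  have Z := D.unique ((hasDerivAt_const b (0 : ℂ)).congr_of_eventuallyEq
    (Filter.Eventually.of_forall fun x => weier τ hτ x y a b))
  have z0 : theta τ 0 = 0 := by
    have := theta_neg τ 0
    rw [neg_zero] at this
    exact self_eq_neg.1 this
  rw [sub_self, z0, show a - b = -(b - a) by ring, theta_neg τ (b - a), show y - b = -(b - y) by ring,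
    theta_neg τ (b - y), add_comm a b, add_comm y b, ← two_mul] at Z
  simp only [E1]
  generalize theta τ (2 * b) = T at *
  field_simp
  linear_combination -Z

theorem three_term_elliptic_identity (τ : ℂ) (hτ : 0 < τ.im) (z w u₁ u₂ v : ℂ)
    (hz : z ∉ Lam τ) (hw : w ∉ Lam τ) (hzw : z - w ∉ Lam τ) (hv : v ∉ Lam τ)
    (hu₁ : u₁ ∉ Lam τ) (hu₂ : u₂ ∉ Lam τ) (hu₁v : u₁ - v ∉ Lam τ)
    (hu₂v : u₂ + v ∉ Lam τ) (hu₁₂v : u₁ - u₂ - v ∉ Lam τ) :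
    phi τ z (u₁ - v) * phi τ w (u₂ + v) * phi τ (z - w) v -
        phi τ z (u₂ + v) * phi τ w (u₁ - v) * phi τ (z - w) (u₁ - u₂ - v) =
      phi τ z u₁ * phi τ w u₂ *
        (E1 τ v - E1 τ (u₁ - u₂ - v) + E1 τ (u₁ - v) - E1 τ (u₂ + v)) := by
  have nz := theta_ne_zero τ hτ z hz
  have nw := theta_ne_zero τ hτ w hw
  have nzw := theta_ne_zero τ hτ _ hzw
  have nv := theta_ne_zero τ hτ _ hv
  have n1 := theta_ne_zero τ hτ _ hu₁
  have n2 := theta_ne_zero τ hτ _ hu₂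
  have n1v := theta_ne_zero τ hτ _ hu₁v
  have n2v := theta_ne_zero τ hτ _ hu₂v
  have n12v := theta_ne_zero τ hτ _ hu₁₂v
  have hE := E1_sum τ hτ (u₂ + v - u₁ / 2) (u₁ / 2) (v - u₁ / 2)
  rw [show u₁ / 2 + (v - u₁ / 2) = v by ring, show u₁ / 2 - (v - u₁ / 2) = u₁ - v by ring,
    show u₁ / 2 + (u₂ + v - u₁ / 2) = u₂ + v by ring,
    show u₁ / 2 - (u₂ + v - u₁ / 2) = u₁ - u₂ - v by ring,
    show 2 * (u₁ / 2) = u₁ by ring,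
    show v - u₁ / 2 + (u₂ + v - u₁ / 2) = -(u₁ - u₂ - 2 * v) by ring,
    show v - u₁ / 2 - (u₂ + v - u₁ / 2) = -u₂ by ring, theta_neg, theta_neg] at hE
  have hE' := hE nv n1v n2v n12v
  have hS : E1 τ v - E1 τ (u₁ - u₂ - v) + E1 τ (u₁ - v) - E1 τ (u₂ + v) =
      theta τ u₁ * deriv (theta τ) 0 * theta τ (u₁ - u₂ - 2 * v) * theta τ u₂ /
      (theta τ v * theta τ (u₁ - v) * theta τ (u₂ + v) * theta τ (u₁ - u₂ - v)) := by
    rw [eq_div_iff (by simp [*])]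
    linear_combination hE'
  have W := weier τ hτ ((z + w + u₁ + u₂) / 2) ((z - w + u₁ - u₂) / 2)
    ((z - w + u₁ - u₂ - 2 * v) / 2) ((z - w - u₁ + u₂ + 2 * v) / 2)
  rw [show (z + w + u₁ + u₂) / 2 + (z - w + u₁ - u₂) / 2 = z + u₁ by ring,
    show (z + w + u₁ + u₂) / 2 - (z - w + u₁ - u₂) / 2 = w + u₂ by ring,
    show (z - w + u₁ - u₂ - 2 * v) / 2 + (z - w - u₁ + u₂ + 2 * v) / 2 = z - w by ring,
    show (z - w + u₁ - u₂ - 2 * v) / 2 - (z - w - u₁ + u₂ + 2 * v) / 2 = u₁ - u₂ - 2 * v by ring,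
    show (z + w + u₁ + u₂) / 2 + (z - w + u₁ - u₂ - 2 * v) / 2 = z + (u₁ - v) by ring,
    show (z + w + u₁ + u₂) / 2 - (z - w + u₁ - u₂ - 2 * v) / 2 = w + (u₂ + v) by ring,
    show (z - w + u₁ - u₂) / 2 + (z - w - u₁ + u₂ + 2 * v) / 2 = z - w + v by ring,
    show (z - w + u₁ - u₂) / 2 - (z - w - u₁ + u₂ + 2 * v) / 2 = u₁ - u₂ - v by ring,
    show (z + w + u₁ + u₂) / 2 + (z - w - u₁ + u₂ + 2 * v) / 2 = z + (u₂ + v) by ring,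
    show (z + w + u₁ + u₂) / 2 - (z - w - u₁ + u₂ + 2 * v) / 2 = w + (u₁ - v) by ring,
    show (z - w + u₁ - u₂) / 2 + (z - w + u₁ - u₂ - 2 * v) / 2 = z - w + (u₁ - u₂ - v) by ring,
    show (z - w + u₁ - u₂) / 2 - (z - w + u₁ - u₂ - 2 * v) / 2 = v by ring] at W
  rw [hS]
  clear hS hE hE'
  simp only [phi]
  generalize theta τ (z + u₁) = a1 at *
  generalize theta τ (w + u₂) = a2 at *
  generalize theta τ (u₁ - u₂ - 2 * v) = a3 at *
  generalize theta τ (z + (u₁ - v)) = a4 at *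
  generalize theta τ (w + (u₂ + v)) = a5 at *
  generalize theta τ (z - w + v) = a6 at *
  generalize theta τ (z + (u₂ + v)) = a7 at *
  generalize theta τ (w + (u₁ - v)) = a8 at *
  generalize theta τ (z - w + (u₁ - u₂ - v)) = a9 at *
  generalize theta τ (u₁ - u₂ - v) = b1 at *
  generalize theta τ (u₁ - v) = b2 at *
  generalize theta τ (u₂ + v) = b3 at *
  generalize theta τ (z - w) = b4 at *
  generalize theta τ v = b5 at *
  generalize theta τ z = b6 at *
  generalize theta τ w = b7 at *
  generalize theta τ u₁ = b8 at *
  generalize theta τ u₂ = b9 at *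
  generalize deriv (theta τ) 0 = d at *
  field_simp
  linear_combination -d ^ 3 * W

end
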